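/- Let T be a strongly minimal arithmetically definable theory, and let M ⊨ T be an arithmetically extendible model with deg_ar(M) = D > 0. If X ⊆ M^m is definable in M with parameters and is infinite, then deg_ar(X) = D. -/

import Mathlib

open FirstOrder FirstOrder.Language

namespace ArMorley

/-! ## Arithmetical sets and arithmetic reducibility -/

/-- Function symbols of the language of arithmetic: `0`, `1`, `+`, `·`. -/
inductive ArFunc : ℕ → Type
  | zero : ArFunc 0
  | one : ArFunc 0
  | add : ArFunc 2
  | mul : ArFunc 2

/-- Relation symbols: `<` and a unary oracle predicate. -/
inductive ArRel : ℕ → Type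
  | lt : ArRel 2
  | mem : ArRel 1

/-- The language `(+, ·, 0, 1, <, Y)` of arithmetic with a unary oracle predicate. -/
def arithLang : FirstOrder.Language := ⟨ArFunc, ArRel⟩

/-- The standard structure on `ℕ`, with the oracle predicate interpreted by `Y`. -/
def arithStructure (Y : Set ℕ) : arithLang.Structure ℕ where
  funMap := fun {n} f =>
    match f with
    | ArFunc.zero => fun _ => 0
    | ArFunc.one => fun _ => 1
    | ArFunc.add => fun v => v 0 + v 1
    | ArFunc.mul => fun v => v 0 * v 1
  RelMap := fun {n} r =>
    match r with
    | ArRel.lt => fun v => v 0 < v 1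
    | ArRel.mem => fun v => v 0 ∈ Y

/-- `X ≤_ar Y` : `X` is definable without parameters in `(ℕ, +, ·, 0, 1, <, Y)`. -/
def ArReducible (X Y : Set ℕ) : Prop :=
  letI := arithStructure Y
  ∃ φ : arithLang.Formula (Fin 1), X = { n : ℕ | φ.Realize (fun _ => n) }

/-- `X` is arithmetical: definable without parameters in `(ℕ, +, ·, 0, 1, <)`. -/
def IsArithmetical (X : Set ℕ) : Prop := ArReducible X ∅

/-- `X` and `Y` have the same arithmetic degree. -/
def ArEquiv (X Y : Set ℕ) : Prop := ArReducible X Y ∧ ArReducible Y X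

/-! ## Coding conventions -/

/-- Code of a list of naturals. -/
def listCode (l : List ℕ) : ℕ := Encodable.encode l

/-- Code of a finite tuple of naturals. -/
def tupleCode {n : ℕ} (v : Fin n → ℕ) : ℕ := listCode (List.ofFn v)

/-- The subset of `ℕ` corresponding to a set of elements of a coded domain. -/
def subCode {A : Set ℕ} (S : Set ↥A) : Set ℕ := Subtype.val '' S

/-- Code of a set of `n`-tuples from a coded domain as a subset of `ℕ`. -/
def tupleSetCode {A : Set ℕ} {n : ℕ} (X : Set (Fin n → ↥A)) : Set ℕ :=
  { c : ℕ | ∃ v ∈ X, c = tupleCode (fun i => ((v i : ℕ))) }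

/-- Code of the graph of a function between coded domains. -/
def graphCode {A B : Set ℕ} (f : ↥A → ↥B) : Set ℕ :=
  { c : ℕ | ∃ a : ↥A, c = Nat.pair (a : ℕ) ((f a : ℕ)) }

/-! ## Gödel coded languages -/

/-- A fixed Gödel coding of the symbols of a countable first-order language. -/
structure GoedelCoding (L : FirstOrder.Language) where
  encFun : ∀ n, L.Functions n → ℕ
  encFun_inj : ∀ n, Function.Injective (encFun n)
  encRel : ∀ n, L.Relations n → ℕ
  encRel_inj : ∀ n, Function.Injective (encRel n)

variable {L : FirstOrder.Language}

/-- The set of codes of the symbols of `L`. -/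
def symbolCodes (g : GoedelCoding L) : Set ℕ :=
  { c | (∃ (n : ℕ) (f : L.Functions n), c = Nat.pair 0 (Nat.pair n (g.encFun n f))) ∨
        (∃ (n : ℕ) (R : L.Relations n), c = Nat.pair 1 (Nat.pair n (g.encRel n R))) }

/-- `L` is an arithmetically definable language. -/
def ArithLang (g : GoedelCoding L) : Prop := IsArithmetical (symbolCodes g)

/-- Code of a term, with a given coding of the variables. -/
def termCode (g : GoedelCoding L) {α : Type} (encα : α → ℕ) (t : L.Term α) : ℕ :=
  listCode (t.listEncode.map (Sum.elim (fun a => Nat.pair 0 (encα a))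
    (fun p => Nat.pair 1 (Nat.pair p.1 (g.encFun p.1 p.2)))))

/-- Code of a (bounded) formula, with a given coding of free variables. -/
def formulaCode (g : GoedelCoding L) {α : Type} (encα : α → ℕ) {n : ℕ}
    (φ : L.BoundedFormula α n) : ℕ :=
  listCode (φ.listEncode.map (Sum.elim
    (fun p => Nat.pair 0 (Nat.pair p.1
      (termCode g (Sum.elim (fun a => Nat.pair 0 (encα a)) (fun i => Nat.pair 1 i.1)) p.2)))
    (Sum.elim
      (fun q => Nat.pair 1 (Nat.pair q.1 (g.encRel q.1 q.2)))
      (fun m => Nat.pair 2 m))))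

/-- Code of a sentence. -/
def sentenceCode (g : GoedelCoding L) (φ : L.Sentence) : ℕ :=
  formulaCode g (fun a : Empty => a.elim) φ

/-- The set of codes of the axioms of a theory. -/
def theoryCode (g : GoedelCoding L) (T : L.Theory) : Set ℕ :=
  { c | ∃ φ ∈ T, c = sentenceCode g φ }

/-- `T` is an arithmetically definable theory. -/
def ArithTheory (g : GoedelCoding L) (T : L.Theory) : Prop := IsArithmetical (theoryCode g T)

/-! ## Coded structures -/

/-- A coded `L`-structure: an `L`-structure whose domain is a subset of `ℕ`
with infinite complement. -/
structure CodedStructure (L : FirstOrder.Language) where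
  carrier : Set ℕ
  compl_infinite : (carrierᶜ : Set ℕ).Infinite
  struc : L.Structure ↥carrier

/-- A coded structure is a model of `T`. -/
def CodedStructure.Models (M : CodedStructure L) (T : L.Theory) : Prop :=
  ∀ φ ∈ T, @Sentence.Realize L ↥M.carrier M.struc φ

/-- The (coded) elementary diagram of a coded structure. -/
def elemDiagram (g : GoedelCoding L) (M : CodedStructure L) : Set ℕ :=
  { c | ∃ (k : ℕ) (φ : L.Formula (Fin k)) (a : Fin k → ↥M.carrier),
      c = Nat.pair (Nat.pair k (formulaCode g Fin.val φ)) (tupleCode fun i => ((a i : ℕ))) ∧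
      (letI := M.struc; φ.Realize a) }

/-- A coded structure is arithmetically decidable if its elementary diagram is arithmetical. -/
def ArithDecidable (g : GoedelCoding L) (M : CodedStructure L) : Prop :=
  IsArithmetical (elemDiagram g M)

/-- `M ≼ N` for coded structures: `M`'s domain is contained in `N`'s, and the
inclusion is elementary. -/
structure ElemSub (M N : CodedStructure L) : Prop where
  subset : M.carrier ⊆ N.carrier
  elem : ∀ (k : ℕ) (φ : L.Formula (Fin k)) (a : Fin k → ↥M.carrier),
    (letI := M.struc; φ.Realize a) ↔
      (letI := N.struc; φ.Realize (fun i => (⟨((a i : ℕ)), subset (a i).2⟩ : ↥N.carrier)))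

/-- A coded model of `T` is arithmetically extendible if it is an elementary substructure of
an arithmetically decidable coded model of `T`. -/
def ArithExtendible (g : GoedelCoding L) (T : L.Theory) (M : CodedStructure L) : Prop :=
  ∃ N : CodedStructure L, ArithDecidable g N ∧ N.Models T ∧ ElemSub M N

/-! ## Model-theoretic notions in arbitrary structures -/

/-- `N` (with structure `SN`) is a model of `T`. -/
def ModelsT (L : FirstOrder.Language) (T : L.Theory) (N : Type) (SN : L.Structure N) : Prop :=
  ∀ φ ∈ T, @Sentence.Realize L N SN φ

/-- `T` has no finite models. -/
def NoFiniteModels (L : FirstOrder.Language) (T : L.Theory) : Prop :=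
  ∀ (N : Type) (SN : L.Structure N), ModelsT L T N SN → Infinite N

/-- Elementary embeddings, with the structures given explicitly. -/
def EEmb (L : FirstOrder.Language) (M : Type) (SM : L.Structure M)
    (N : Type) (SN : L.Structure N) : Type _ :=
  @FirstOrder.Language.ElementaryEmbedding L M N SM SN

/-- The underlying map of an elementary embedding. -/
def EEmb.fn {L : FirstOrder.Language} {M : Type} {SM : L.Structure M}
    {N : Type} {SN : L.Structure N} (j : EEmb L M SM N SN) : M → N :=
  @FirstOrder.Language.ElementaryEmbedding.toFun L M N SM SN j

/-- A subset of `N^n` definable with parameters from `P`. -/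
def DefinableOverT (L : FirstOrder.Language) (N : Type) (SN : L.Structure N) (P : Set N)
    {n : ℕ} (X : Set (Fin n → N)) : Prop :=
  letI := SN
  ∃ (m : ℕ) (ψ : L.Formula (Fin n ⊕ Fin m)) (b : Fin m → N),
    (∀ i, b i ∈ P) ∧ X = { v | ψ.Realize (Sum.elim v b) }

/-- A subset of `N` definable with (arbitrary) parameters. -/
def Definable1 (L : FirstOrder.Language) (N : Type) (SN : L.Structure N) (Y : Set N) : Prop :=
  letI := SN
  ∃ (m : ℕ) (ψ : L.Formula (Fin 1 ⊕ Fin m)) (b : Fin m → N),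
    Y = { x : N | ψ.Realize (Sum.elim (fun _ => x) b) }

/-- The algebraic closure of `B` in `N`: elements satisfying a formula with parameters
from `B` having finitely many solutions. -/
def aclIn (L : FirstOrder.Language) (N : Type) (SN : L.Structure N) (B : Set N) : Set N :=
  letI := SN
  { a : N | ∃ (k : ℕ) (φ : L.Formula (Fin 1 ⊕ Fin k)) (b : Fin k → N),
      (∀ i, b i ∈ B) ∧ φ.Realize (Sum.elim (fun _ => a) b) ∧
      { x : N | φ.Realize (Sum.elim (fun _ => x) b) }.Finite }

/-- The domain of the substructure of `N` generated by `B`: values of terms at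
arguments from `B`. -/
def genSub (L : FirstOrder.Language) (N : Type) (SN : L.Structure N) (B : Set N) : Set N :=
  letI := SN
  { a : N | ∃ (t : L.Term ℕ) (v : ℕ → N), (∀ i, v i ∈ B) ∧ a = t.realize v }

/-- The set defined by a formula `φ(x, p̄)` in one free variable with parameters `p̄`. -/
def smSet (L : FirstOrder.Language) (N : Type) (SN : L.Structure N) {k : ℕ}
    (φ : L.Formula (Fin 1 ⊕ Fin k)) (p : Fin k → N) : Set N :=
  letI := SN
  { x : N | φ.Realize (Sum.elim (fun _ => x) p) }

/-- A definable tuple-set in a coded structure, with parameters from `P`. -/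
def DefinableOver (M : CodedStructure L) (P : Set ↥M.carrier) {n : ℕ}
    (X : Set (Fin n → ↥M.carrier)) : Prop :=
  DefinableOverT L ↥M.carrier M.struc P X

/-- A definable tuple-set in a coded structure, with arbitrary parameters. -/
def DefinableIn (M : CodedStructure L) {n : ℕ} (X : Set (Fin n → ↥M.carrier)) : Prop :=
  DefinableOver M Set.univ X

/-! ## Isomorphisms of coded structures and `D`-categoricity -/

/-- An isomorphism of coded `L`-structures. -/
structure CodedIso (M N : CodedStructure L) where
  toFun : ↥M.carrier → ↥N.carrier
  invFun : ↥N.carrier → ↥M.carrier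
  left_inv : Function.LeftInverse invFun toFun
  right_inv : Function.RightInverse invFun toFun
  map_fun : ∀ {k : ℕ} (f : L.Functions k) (v : Fin k → ↥M.carrier),
    toFun (M.struc.funMap f v) = N.struc.funMap f (toFun ∘ v)
  map_rel : ∀ {k : ℕ} (r : L.Relations k) (v : Fin k → ↥M.carrier),
    M.struc.RelMap r v ↔ N.struc.RelMap r (toFun ∘ v)

/-- `f` is a `D`-preserving isomorphism, where `d` is a representative of the
arithmetic degree `D`. -/
def DPreserving (d : Set ℕ) {M N : CodedStructure L} (f : CodedIso M N) : Prop :=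
  ArReducible (graphCode f.toFun) d ∧
  ArReducible (graphCode f.invFun) d ∧
  (∀ (n : ℕ) (X : Set (Fin n → ↥M.carrier)), DefinableIn M X →
      ArEquiv (tupleSetCode X) d →
      ArEquiv (tupleSetCode ((fun v => f.toFun ∘ v) '' X)) d) ∧
  (∀ (n : ℕ) (Y : Set (Fin n → ↥N.carrier)), DefinableIn N Y →
      ArEquiv (tupleSetCode Y) d →
      ArEquiv (tupleSetCode ((fun v => f.invFun ∘ v) '' Y)) d)

/-- `T` is `D`-categorical, where `d` is a representative of the nonzero
arithmetic degree `D`. -/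
def DCategorical (g : GoedelCoding L) (T : L.Theory) (d : Set ℕ) : Prop :=
  ∀ M₀ M₁ M₂ : CodedStructure L,
    ArithDecidable g M₀ → M₀.Models T →
    M₁.Models T → ArithExtendible g T M₁ →
    M₂.Models T → ArithExtendible g T M₂ →
    ElemSub M₀ M₁ → ElemSub M₀ M₂ →
    ArEquiv M₁.carrier d → ArEquiv M₂.carrier d →
    ∃ f : CodedIso M₁ M₂, DPreserving d f ∧
      ∀ (x : ℕ) (hx : x ∈ M₀.carrier) (h₁ : x ∈ M₁.carrier),
        ((f.toFun ⟨x, h₁⟩ : ℕ)) = x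

/-! ## Vaughtian pairs, prime models, strong minimality -/

/-- `T` has a Vaughtian pair. -/
def HasVaughtianPair (T : L.Theory) : Prop :=
  ∃ (N : Type) (SN : L.Structure N),
    ModelsT L T N SN ∧
    ∃ S : @FirstOrder.Language.ElementarySubstructure L N SN,
      ((S.toSubstructure : Set N) ≠ Set.univ ∧
      ∃ (k : ℕ) (φ : L.Formula (Fin 1 ⊕ Fin k)) (a : Fin k → N),
        (∀ i, a i ∈ (S.toSubstructure : Set N)) ∧
        smSet L N SN φ a ⊆ (S.toSubstructure : Set N) ∧
        (smSet L N SN φ a).Infinite)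

/-- A coded model of `T` is prime: it elementarily embeds into every model of `T`. -/
def PrimeModel (L : FirstOrder.Language) (T : L.Theory) (P : CodedStructure L) : Prop :=
  P.Models T ∧ ∀ (N : Type) (SN : L.Structure N), ModelsT L T N SN →
    Nonempty (EEmb L ↥P.carrier P.struc N SN)

/-- `φ(x, p̄)` is strongly minimal over the coded model `M`: its solution set in `M` is
infinite, and in every elementary extension of `M` modelling `T` every definable subset of
its solution set is finite or cofinite in it. -/
def StronglyMinimalOver (T : L.Theory) (M : CodedStructure L) {k : ℕ}
    (φ : L.Formula (Fin 1 ⊕ Fin k)) (p : Fin k → ↥M.carrier) : Prop :=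
  (smSet L ↥M.carrier M.struc φ p).Infinite ∧
  ∀ (N : Type) (SN : L.Structure N), ModelsT L T N SN →
    ∀ j : EEmb L ↥M.carrier M.struc N SN,
      ∀ Y : Set N, Definable1 L N SN Y →
        Y ⊆ smSet L N SN φ (fun i => j.fn (p i)) →
        (Y.Finite ∨ ((smSet L N SN φ (fun i => j.fn (p i))) \ Y).Finite)

/-- `T` is a strongly minimal theory: every model is infinite, and every
parameter-definable subset of any model is finite or cofinite. -/
def StronglyMinimalTheory (L : FirstOrder.Language) (T : L.Theory) : Prop :=
  (∀ (N : Type) (SN : L.Structure N), ModelsT L T N SN → Infinite N) ∧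
  (∀ (N : Type) (SN : L.Structure N), ModelsT L T N SN →
    ∀ Y : Set N, Definable1 L N SN Y → (Y.Finite ∨ (Yᶜ : Set N).Finite))

/-- The structural control clause: an arithmetically decidable prime model together with
a strongly minimal formula over it generating every elementary extension. -/
def GeneratesAll (T : L.Theory) (P : CodedStructure L) {k : ℕ}
    (φ : L.Formula (Fin 1 ⊕ Fin k)) (p : Fin k → ↥P.carrier) : Prop :=
  ∀ (N : Type) (SN : L.Structure N), ModelsT L T N SN →
    ∀ j : EEmb L ↥P.carrier P.struc N SN,
      aclIn L N SN (Set.range j.fn ∪ smSet L N SN φ (fun i => j.fn (p i))) = Set.univ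

/-- Clause (3) of the arithmetic Baldwin–Lachlan theorem. -/
def SMControl (g : GoedelCoding L) (T : L.Theory) : Prop :=
  ∃ (P : CodedStructure L), ArithDecidable g P ∧ PrimeModel L T P ∧
    ∃ (k : ℕ) (φ : L.Formula (Fin 1 ⊕ Fin k)) (p : Fin k → ↥P.carrier),
      StronglyMinimalOver T P φ p ∧ GeneratesAll T P φ p

/-! ## Types and arithmetical stability -/

/-- A formula with a finite parameter tuple from a coded structure, in `n` object
variables. -/
def ParamFormula (L : FirstOrder.Language) (M : CodedStructure L) (n : ℕ) : Type :=
  Σ k : ℕ, L.Formula (Fin n ⊕ Fin k) × (Fin k → ↥M.carrier)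

/-- All parameters of `q` lie in `A`. -/
def paramsIn {M : CodedStructure L} {n : ℕ} (A : Set ℕ) (q : ParamFormula L M n) : Prop :=
  ∀ i, ((q.2.2 i : ℕ)) ∈ A

/-- `p` is consistent with the elementary diagram of `M`: it is realized in some
elementary extension of `M`. -/
def TypeConsistent (M : CodedStructure L) {n : ℕ} (p : Set (ParamFormula L M n)) : Prop :=
  ∃ (N : Type) (SN : L.Structure N) (j : EEmb L ↥M.carrier M.struc N SN) (b : Fin n → N),
    ∀ q ∈ p, letI := SN; q.2.1.Realize (Sum.elim b (fun i => j.fn (q.2.2 i)))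

/-- `p` is a (complete) `n`-type over `A` inside `M`: a maximal set of formulas with
parameters from `A` consistent with the elementary diagram of `M`. -/
def IsNType (M : CodedStructure L) (A : Set ℕ) (n : ℕ)
    (p : Set (ParamFormula L M n)) : Prop :=
  (∀ q ∈ p, paramsIn A q) ∧
  TypeConsistent M p ∧
  ∀ q : ParamFormula L M n, paramsIn A q → q ∉ p → ¬ TypeConsistent M (insert q p)

/-- The code of a formula-with-parameters. -/
def pfCode (g : GoedelCoding L) {M : CodedStructure L} {n : ℕ} (q : ParamFormula L M n) : ℕ :=
  Nat.pair
    (Nat.pair q.1 (formulaCode g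
      (Sum.elim (fun i : Fin n => Nat.pair 0 i.1) (fun j : Fin q.1 => Nat.pair 1 j.1)) q.2.1))
    (tupleCode fun i => ((q.2.2 i : ℕ)))

/-- The set of codes of the formulas of `p`. -/
def typeCode (g : GoedelCoding L) {M : CodedStructure L} {n : ℕ}
    (p : Set (ParamFormula L M n)) : Set ℕ :=
  { c | ∃ q ∈ p, c = pfCode g q }

/-- `p` is realized in the coded elementary extension `N` of `M`. -/
def RealizesType {M N : CodedStructure L} (h : M.carrier ⊆ N.carrier) {n : ℕ}
    (p : Set (ParamFormula L M n)) : Prop :=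
  ∃ b : Fin n → ↥N.carrier, ∀ q ∈ p,
    letI := N.struc
    q.2.1.Realize (Sum.elim b (fun i => (⟨((q.2.2 i : ℕ)), h (q.2.2 i).2⟩ : ↥N.carrier)))

/-- The `(n, i)`-th column of an effective join. -/
def tripleSection (X : Set ℕ) (n i : ℕ) : Set ℕ := { m | Nat.pair n (Nat.pair i m) ∈ X }

/-- `T` is arithmetically stable: over every arithmetically decidable model and every
arithmetical parameter set, the family of arithmetic `n`-types (for all `n ≥ 1`) has a
uniform arithmetical code in which every arithmetic `n`-type appears at least once. -/
def ArithStable (g : GoedelCoding L) (T : L.Theory) : Prop :=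
  ∀ M : CodedStructure L, ArithDecidable g M → M.Models T →
    ∀ A : Set ℕ, A ⊆ M.carrier → IsArithmetical A →
      ∃ X : Set ℕ, IsArithmetical X ∧
        (∀ n, 1 ≤ n → ∀ i : ℕ, ∃ p : Set (ParamFormula L M n),
            IsNType M A n p ∧ IsArithmetical (typeCode g p) ∧
            tripleSection X n i = typeCode g p) ∧
        (∀ n, 1 ≤ n → ∀ p : Set (ParamFormula L M n),
            IsNType M A n p → IsArithmetical (typeCode g p) →
            ∃ i : ℕ, tripleSection X n i = typeCode g p)

/-- The set of elements occurring as a coordinate of a tuple in `X`. -/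
def coordSet {N : Type} {n : ℕ} (X : Set (Fin n → N)) : Set N :=
  { m | ∃ v ∈ X, ∃ i, v i = m }


/-! ## Closure properties of arithmetical definability -/

/-- A relation on assignments `α → ℕ` is arithmetically definable from the oracle `Y`. -/
def ArDef (Y : Set ℕ) {α : Type} (P : (α → ℕ) → Prop) : Prop :=
  letI := arithStructure Y
  ∃ φ : arithLang.Formula α, ∀ v, φ.Realize v ↔ P v

/-- A function on assignments has a graph arithmetically definable from the oracle `Y`. -/
def ArDefFun (Y : Set ℕ) {α : Type} (f : (α → ℕ) → ℕ) : Prop :=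
  ArDef Y fun w : Option α → ℕ => w none = f fun a => w (some a)

section ArDef

variable {Y : Set ℕ} {α β : Type}

theorem ArDef.congr {P Q : (α → ℕ) → Prop} (h : ArDef Y P) (hPQ : ∀ v, P v ↔ Q v) :
    ArDef Y Q := by
  obtain ⟨φ, hφ⟩ := h
  exact ⟨φ, fun v => (hφ v).trans (hPQ v)⟩

theorem ArDef.false : ArDef Y fun _ : α → ℕ => False := by
  let := arithStructure Y
  exact ⟨⊥, fun v => Formula.realize_bot⟩

theorem ArDef.imp {P Q : (α → ℕ) → Prop} (hP : ArDef Y P) (hQ : ArDef Y Q) :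
    ArDef Y fun v => P v → Q v := by
  let := arithStructure Y
  obtain ⟨φ, hφ⟩ := hP
  obtain ⟨ψ, hψ⟩ := hQ
  exact ⟨φ.imp ψ, fun v => by rw [Formula.realize_imp, hφ, hψ]⟩

theorem ArDef.not {P : (α → ℕ) → Prop} (hP : ArDef Y P) : ArDef Y fun v => ¬ P v :=
  hP.imp .false

theorem ArDef.and {P Q : (α → ℕ) → Prop} (hP : ArDef Y P) (hQ : ArDef Y Q) :
    ArDef Y fun v => P v ∧ Q v :=
  (hP.imp hQ.not).not.congr fun v => by tauto

theorem ArDef.or {P Q : (α → ℕ) → Prop} (hP : ArDef Y P) (hQ : ArDef Y Q) :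
    ArDef Y fun v => P v ∨ Q v :=
  (hP.not.imp hQ).congr fun v => by tauto

theorem ArDef.forall_finite [Finite β] {P : β → (α → ℕ) → Prop} (hP : ∀ b, ArDef Y (P b)) :
    ArDef Y fun v => ∀ b, P b v := by
  let := arithStructure Y
  choose φ hφ using hP
  exact ⟨Formula.iInf φ, fun v => by simp only [Formula.realize_iInf, hφ]⟩

theorem ArDef.exists [Finite β] {P : (α → ℕ) → (β → ℕ) → Prop}
    (hP : ArDef Y fun w : α ⊕ β → ℕ => P (w ∘ Sum.inl) (w ∘ Sum.inr)) :
    ArDef Y fun v => ∃ w, P v w := by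
  let := arithStructure Y
  obtain ⟨φ, hφ⟩ := hP
  exact ⟨φ.iExs β, fun v => by simp only [Formula.realize_iExs, hφ]; rfl⟩

theorem ArDef.comp {P : (β → ℕ) → Prop} (hP : ArDef Y P) (e : β → α) :
    ArDef Y fun v => P (v ∘ e) := by
  let := arithStructure Y
  obtain ⟨φ, hφ⟩ := hP
  exact ⟨φ.relabel e, fun v => by rw [Formula.realize_relabel, hφ]⟩

/-- Substituting definable functions into a definable relation. -/
theorem ArDef.subst [Finite β] {P : (β → ℕ) → Prop} (hP : ArDef Y P)
    {f : β → (α → ℕ) → ℕ} (hf : ∀ b, ArDefFun Y (f b)) :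
    ArDef Y fun v => P fun b => f b v := by
  have h : ArDef Y fun v => ∃ w : β → ℕ, (∀ b, w b = f b v) ∧ P w := by
    refine ArDef.exists (P := fun v w => (∀ b, w b = f b v) ∧ P w) (ArDef.and ?_ (hP.comp Sum.inr))
    refine ArDef.forall_finite fun b => ?_
    exact (hf b).comp fun o : Option α => o.elim (Sum.inr b) Sum.inl
  refine h.congr fun v => ⟨?_, fun hv => ⟨_, fun _ => rfl, hv⟩⟩
  rintro ⟨w, hw, hPw⟩
  rwa [← funext hw]

theorem ArDef.mem : ArDef Y fun v : Fin 1 → ℕ => v 0 ∈ Y := by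
  let := arithStructure Y
  exact ⟨Relations.formula₁ (L := arithLang) ArRel.mem (Term.var 0), fun _ =>
    Formula.realize_rel₁⟩

theorem ArDef.lt : ArDef Y fun v : Fin 2 → ℕ => v 0 < v 1 := by
  let := arithStructure Y
  exact ⟨Relations.formula₂ (L := arithLang) ArRel.lt (Term.var 0) (Term.var 1), fun _ =>
    Formula.realize_rel₂⟩

theorem ArDef.eq : ArDef Y fun v : Fin 2 → ℕ => v 0 = v 1 := by
  let := arithStructure Y
  exact ⟨Term.equal (Term.var 0) (Term.var 1), fun v => by
    rw [Formula.realize_equal]; rfl⟩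

theorem ArDefFun.var (a : α) : ArDefFun Y fun v => v a :=
  ArDef.eq.comp ![none, some a]

theorem ArDefFun.lt {f h : (α → ℕ) → ℕ} (hf : ArDefFun Y f) (hh : ArDefFun Y h) :
    ArDef Y fun v => f v < h v :=
  ArDef.lt.subst (f := ![f, h]) (Fin.forall_fin_two.2 ⟨hf, hh⟩)

theorem ArDefFun.eq {f h : (α → ℕ) → ℕ} (hf : ArDefFun Y f) (hh : ArDefFun Y h) :
    ArDef Y fun v => f v = h v :=
  ArDef.eq.subst (f := ![f, h]) (Fin.forall_fin_two.2 ⟨hf, hh⟩)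

/-- Substituting definable functions into a definable function. -/
theorem ArDefFun.subst [Finite β] {F : (β → ℕ) → ℕ} (hF : ArDefFun Y F)
    {f : β → (α → ℕ) → ℕ} (hf : ∀ b, ArDefFun Y (f b)) :
    ArDefFun Y fun v => F fun b => f b v := by
  refine ArDef.subst (f := fun (o : Option β) (w : Option α → ℕ) =>
    o.elim (w none) fun b => f b fun a => w (some a)) hF ?_
  rintro (_ | b)
  · exact ArDefFun.var none
  · exact (hf b).comp fun o : Option α => o.elim none fun a => some (some a)

theorem ArDefFun.term (Z : Set ℕ) (t : arithLang.Term α) :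
    ArDefFun Y fun v => (letI := arithStructure Z; t.realize v) := by
  let := arithStructure Y
  refine ⟨Term.equal (Term.var none) (t.relabel some), fun v => ?_⟩
  rw [Formula.realize_equal, Term.realize_relabel]
  suffices h : ∀ w : α → ℕ, t.realize w = @Term.realize _ _ (arithStructure Z) _ w t by
    rw [h]; rfl
  intro w
  induction t with
  | var => rfl
  | func f ts ih => cases f <;> simp only [Term.realize, ih] <;> rfl

theorem ArDefFun.add {f h : (α → ℕ) → ℕ} (hf : ArDefFun Y f) (hh : ArDefFun Y h) :
    ArDefFun Y fun v => f v + h v :=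
  ArDefFun.subst (F := fun v : Fin 2 → ℕ => v 0 + v 1) (f := ![f, h])
    (ArDefFun.term ∅ (Functions.apply₂ (L := arithLang) ArFunc.add (Term.var 0) (Term.var 1)))
    (Fin.forall_fin_two.2 ⟨hf, hh⟩)

theorem ArDefFun.mul {f h : (α → ℕ) → ℕ} (hf : ArDefFun Y f) (hh : ArDefFun Y h) :
    ArDefFun Y fun v => f v * h v :=
  ArDefFun.subst (F := fun v : Fin 2 → ℕ => v 0 * v 1) (f := ![f, h])
    (ArDefFun.term ∅ (Functions.apply₂ (L := arithLang) ArFunc.mul (Term.var 0) (Term.var 1)))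
    (Fin.forall_fin_two.2 ⟨hf, hh⟩)

theorem ArDefFun.const (n : ℕ) : ArDefFun Y fun _ : α → ℕ => n := by
  induction n with
  | zero => exact ArDefFun.term ∅ (Constants.term (L := arithLang) ArFunc.zero)
  | succ n ih => exact ih.add (ArDefFun.term ∅ (Constants.term (L := arithLang) ArFunc.one))

theorem ArDefFun.ite {P : (α → ℕ) → Prop} [DecidablePred P] {f h : (α → ℕ) → ℕ} (hP : ArDef Y P)
    (hf : ArDefFun Y f) (hh : ArDefFun Y h) : ArDefFun Y fun v => if P v then f v else h v := by
  have hP' : ArDef Y fun w : Option α → ℕ => P fun a => w (some a) := hP.comp some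
  refine ((hP'.and hf).or (hP'.not.and hh)).congr fun w => ?_
  by_cases hw : P fun a => w (some a) <;> simp [hw]

theorem ArDefFun.pair {f h : (α → ℕ) → ℕ} (hf : ArDefFun Y f) (hh : ArDefFun Y h) :
    ArDefFun Y fun v => Nat.pair (f v) (h v) :=
  .ite (hf.lt hh) ((hh.mul hh).add hf) (((hf.mul hf).add hf).add hh)

theorem ArDefFun.tupleCode {n : ℕ} {f : Fin n → (α → ℕ) → ℕ} (hf : ∀ i, ArDefFun Y (f i)) :
    ArDefFun Y fun v => tupleCode fun i => f i v := by
  induction n with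
  | zero => exact .const _
  | succ n ih =>
    have h := ((hf 0).pair (ih fun i => hf i.succ)).add (.const 1)
    simpa [ArMorley.tupleCode, listCode, List.ofFn_succ] using h

theorem ArDef.mem_of {f : (α → ℕ) → ℕ} {X : Set ℕ} (hX : ArDef Y fun v : Fin 1 → ℕ => v 0 ∈ X)
    (hf : ArDefFun Y f) : ArDef Y fun v => f v ∈ X :=
  hX.subst (f := fun _ => f) fun _ => hf

theorem ArDef.mem_finite {F : Set ℕ} (hF : F.Finite) (a : α) : ArDef Y fun v => v a ∈ F := by
  induction F, hF using Set.Finite.induction_on with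
  | empty => exact .false
  | @insert n F _ _ ih => exact ((ArDefFun.var a).eq (.const n)).or ih

/-- A relation definable from `Z` is definable from `Y` when `Z` is. -/
theorem ArDef.trans {Z : Set ℕ} (hZ : ArDef Y fun v : Fin 1 → ℕ => v 0 ∈ Z)
    {P : (α → ℕ) → Prop} (hP : ArDef Z P) : ArDef Y P := by
  let := arithStructure Z
  obtain ⟨φ, hφ⟩ := hP
  suffices h : ∀ {n : ℕ} (ψ : arithLang.BoundedFormula α n),
      ArDef Y fun w : α ⊕ Fin n → ℕ => ψ.Realize (w ∘ Sum.inl) (w ∘ Sum.inr) by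
    refine ((h φ).comp (Sum.elim id Fin.elim0)).congr fun v => (iff_of_eq ?_).trans (hφ v)
    exact congrArg _ (Subsingleton.elim _ _)
  intro n ψ
  induction ψ with
  | falsum => exact .false
  | equal t₁ t₂ =>
    refine ((ArDefFun.term Z t₁).eq (ArDefFun.term Z t₂)).congr fun w => ?_
    simp only [BoundedFormula.Realize, Sum.elim_comp_inl_inr]
  | rel R ts =>
    cases R with
    | lt =>
      refine ((ArDefFun.term Z (ts 0)).lt (ArDefFun.term Z (ts 1))).congr fun w => ?_
      simp only [BoundedFormula.Realize, Sum.elim_comp_inl_inr]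
      rfl
    | mem =>
      refine (hZ.mem_of (ArDefFun.term Z (ts 0))).congr fun w => ?_
      simp only [BoundedFormula.Realize, Sum.elim_comp_inl_inr]
      rfl
  | imp _ _ ih₁ ih₂ => exact ih₁.imp ih₂
  | @all n ψ ih =>
    have h : ArDef Y fun w : α ⊕ Fin n → ℕ => ∃ x : Fin 1 → ℕ,
        ¬ ψ.Realize (w ∘ Sum.inl) (Fin.snoc (w ∘ Sum.inr) (x 0)) := by
      refine ArDef.exists (P := fun w x =>
        ¬ ψ.Realize (w ∘ Sum.inl) (Fin.snoc (w ∘ Sum.inr) (x 0))) (ArDef.not ?_)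
      refine (ih.comp (Sum.elim (fun a => Sum.inl (Sum.inl a))
        (Fin.snoc (α := fun _ => (α ⊕ Fin n) ⊕ Fin 1) (fun i => Sum.inl (Sum.inr i))
          (Sum.inr 0)))).congr fun w => ?_
      refine iff_of_eq (congrArg₂ _ rfl (funext fun i => ?_))
      refine Fin.lastCases ?_ (fun j => ?_) i <;> simp
    refine h.not.congr fun w => ?_
    simp only [BoundedFormula.Realize, not_exists, not_not]
    exact ⟨fun hw x => hw fun _ => x, fun hw x => hw (x 0)⟩

theorem arReducible_iff {X : Set ℕ} : ArReducible X Y ↔ ArDef Y fun v : Fin 1 → ℕ => v 0 ∈ X := by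
  let := arithStructure Y
  constructor
  · rintro ⟨φ, rfl⟩
    refine ⟨φ, fun v => ?_⟩
    exact iff_of_eq (congrArg _ (funext fun i => congrArg v (Subsingleton.elim i 0)))
  · rintro ⟨φ, hφ⟩
    exact ⟨φ, Set.ext fun n => (hφ fun _ => n).symm⟩

theorem ArReducible.trans {X Y Z : Set ℕ} (h₁ : ArReducible X Y) (h₂ : ArReducible Y Z) :
    ArReducible X Z :=
  arReducible_iff.2 ((arReducible_iff.1 h₂).trans (arReducible_iff.1 h₁))

theorem IsArithmetical.arReducible {X : Set ℕ} (h : IsArithmetical X) : ArReducible X Y :=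
  ArReducible.trans h (arReducible_iff.2 .false)

end ArDef

/-! ## Injectivity of the codings -/

theorem tupleCode_injective {n : ℕ} : Function.Injective (tupleCode (n := n)) := fun _ _ h =>
  List.ofFn_injective (Encodable.encode_injective h)

theorem termCode_injective (g : GoedelCoding L) {α : Type} {e : α → ℕ} (he : e.Injective) :
    Function.Injective (termCode g e) := by
  refine Encodable.encode_injective.comp (Function.Injective.comp (List.map_injective_iff.2 ?_)
    Term.listEncode_injective)
  rintro (a | ⟨n, f⟩) (b | ⟨k, h⟩) hab
  · simpa [he.eq_iff] using hab
  · simp at hab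
  · simp at hab
  · simp only [Sum.elim_inr, Nat.pair_eq_pair, true_and] at hab
    obtain ⟨rfl, hab⟩ := hab
    rw [g.encFun_inj _ hab]

theorem formulaCode_injective (g : GoedelCoding L) {α : Type} {e : α → ℕ} (he : e.Injective)
    {n : ℕ} : Function.Injective fun φ : L.BoundedFormula α n => formulaCode g e φ := by
  intro φ ψ h
  suffices hl : φ.listEncode = ψ.listEncode by
    simpa using BoundedFormula.listEncode_sigma_injective
      (a₁ := (⟨n, φ⟩ : Σ n, L.BoundedFormula α n)) (a₂ := ⟨n, ψ⟩) hl
  refine List.map_injective_iff.2 ?_ (Encodable.encode_injective h)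
  rintro (⟨k, s⟩ | ⟨k, R⟩ | i) (⟨l, t⟩ | ⟨l, S⟩ | j) hab
  all_goals simp only [Sum.elim_inl, Sum.elim_inr, Nat.pair_eq_pair, true_and,
    false_and, zero_ne_one, one_ne_zero, OfNat.ofNat_ne_zero, OfNat.ofNat_ne_one,
    OfNat.zero_ne_ofNat, OfNat.one_ne_ofNat] at hab
  · obtain ⟨rfl, hab⟩ := hab
    have hv : Function.Injective (Sum.elim (fun a : α => Nat.pair 0 (e a))
        fun i : Fin k => Nat.pair 1 i.1) := by
      rintro (a | i) (b | j) hij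
      · simpa [he.eq_iff] using hij
      · simp at hij
      · simp at hij
      · simpa [Fin.ext_iff] using hij
    rw [termCode_injective g hv hab]
  · obtain ⟨rfl, hab⟩ := hab
    rw [g.encRel_inj _ hab]
  · rw [hab]

theorem mem_elemDiagram_iff (g : GoedelCoding L) (N : CodedStructure L) {k : ℕ}
    (φ : L.Formula (Fin k)) (a : Fin k → ℕ) :
    Nat.pair (Nat.pair k (formulaCode g Fin.val φ)) (tupleCode a) ∈ elemDiagram g N ↔
      ∃ h : ∀ i, a i ∈ N.carrier,
        (letI := N.struc; φ.Realize fun i => (⟨a i, h i⟩ : ↥N.carrier)) := by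
  constructor
  · rintro ⟨l, ψ, b, hc, hψ⟩
    simp only [Nat.pair_eq_pair] at hc
    obtain ⟨⟨rfl, hφ⟩, ha⟩ := hc
    obtain rfl := formulaCode_injective g Fin.val_injective hφ
    obtain rfl := tupleCode_injective ha
    exact ⟨fun i => (b i).2, hψ⟩
  · rintro ⟨h, hφ⟩
    exact ⟨k, φ, _, rfl, hφ⟩

/-! ## Definable sets in extendible models -/

/-- A definable set in an arithmetically extendible model is arithmetical in the domain. -/
theorem DefinableIn.tupleSetCode_arReducible (g : GoedelCoding L) {T : L.Theory}
    {M : CodedStructure L} (hext : ArithExtendible g T M) {m : ℕ} {X : Set (Fin m → ↥M.carrier)}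
    (hX : DefinableIn M X) : ArReducible (tupleSetCode X) M.carrier := by
  obtain ⟨N, hN, -, hMN⟩ := hext
  obtain ⟨k, ψ, b, -, rfl⟩ := hX
  let := M.struc
  have hdiag := arReducible_iff.1 (IsArithmetical.arReducible (Y := M.carrier) hN)
  set φ : L.Formula (Fin (m + k)) := ψ.relabel finSumFinEquiv with hφ
  have key : ∀ v : Fin m → ↥M.carrier, ψ.Realize (Sum.elim v b) ↔
      Nat.pair (Nat.pair (m + k) (formulaCode g Fin.val φ))
        (tupleCode (Fin.append (fun i => (v i : ℕ)) fun j => (b j : ℕ))) ∈ elemDiagram g N := by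
    intro v
    have hval : (Fin.append (fun i => (v i : ℕ)) fun j => (b j : ℕ)) =
        fun i => ((Fin.append v b i : ↥M.carrier) : ℕ) := by
      funext i
      refine Fin.addCases (fun j => ?_) (fun j => ?_) i <;> simp
    have hreal : φ.Realize (Fin.append v b) ↔ ψ.Realize (Sum.elim v b) := by
      rw [hφ, Formula.realize_relabel]
      refine iff_of_eq (congrArg _ (funext ?_))
      rintro (i | i) <;> simp
    rw [hval, mem_elemDiagram_iff, ← hreal, hMN.elem]
    exact ⟨fun h => ⟨_, h⟩, fun h => h.2⟩
  have h : ArDef M.carrier fun c : Fin 1 → ℕ => ∃ v : Fin m → ℕ,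
      (∀ i, v i ∈ M.carrier) ∧ c 0 = tupleCode v ∧
      Nat.pair (Nat.pair (m + k) (formulaCode g Fin.val φ))
        (tupleCode (Fin.append v fun j => (b j : ℕ))) ∈ elemDiagram g N := by
    refine ArDef.exists (P := fun (c : Fin 1 → ℕ) (v : Fin m → ℕ) =>
      (∀ i, v i ∈ M.carrier) ∧ c 0 = tupleCode v ∧
      Nat.pair (Nat.pair (m + k) (formulaCode g Fin.val φ))
        (tupleCode (Fin.append v fun j => (b j : ℕ))) ∈ elemDiagram g N)
      (.and (.forall_finite fun i => ArDef.mem.mem_of (.var (Sum.inr i)))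
        (.and ((ArDefFun.var (Sum.inl 0)).eq (.tupleCode fun i => .var (Sum.inr i)))
          (hdiag.mem_of (.pair (.const _) (.tupleCode fun i => ?_)))))
    refine Fin.addCases (fun j => ?_) (fun j => ?_) i
    · simpa using ArDefFun.var (Sum.inr j)
    · simpa using ArDefFun.const _
  refine arReducible_iff.2 (h.congr fun c => ⟨?_, ?_⟩)
  · rintro ⟨v, hv, hc, hd⟩
    exact ⟨fun i => ⟨v i, hv i⟩, (key _).2 hd, hc⟩
  · rintro ⟨v, hv, hc⟩
    exact ⟨fun i => v i, fun i => (v i).2, hc, (key v).1 hv⟩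

/-- Coordinate projections of definable sets are definable. -/
theorem DefinableOverT.definable1_image_eval {N : Type} {SN : L.Structure N} {P : Set N} {m : ℕ}
    {X : Set (Fin m → N)} (hX : DefinableOverT L N SN P X) (i : Fin m) :
    Definable1 L N SN ((fun v => v i) '' X) := by
  obtain ⟨k, ψ, b, -, rfl⟩ := hX
  refine ⟨k, Formula.iExs (Fin m)
    ((Term.equal (Term.var (Sum.inr i)) (Term.var (Sum.inl (Sum.inl 0)))) ⊓
      ψ.relabel (Sum.elim Sum.inr fun j => Sum.inl (Sum.inr j))), b, Set.ext fun x => ?_⟩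
  simp only [Set.mem_image, Set.mem_ofPred_eq, Formula.realize_iExs, Formula.realize_inf,
    Formula.realize_equal, Term.realize_var, Sum.elim_inr, Sum.elim_inl, Formula.realize_relabel]
  refine exists_congr fun v => ?_
  rw [and_comm]
  refine and_congr_right fun _ => iff_of_eq (congrArg _ (funext ?_))
  rintro (j | j) <;> rfl

/-- An infinite set of tuples has an infinite coordinate projection. -/
theorem exists_infinite_image_eval {N : Type} {m : ℕ} {X : Set (Fin m → N)} (hX : X.Infinite) :
    ∃ i, ((fun v => v i) '' X).Infinite := by
  by_contra! h
  refine hX ((Set.Finite.pi' fun i => h i).subset fun v hv i => ?_)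
  exact ⟨v, hv, rfl⟩

/-- The domain is arithmetical in any set of tuples with a cofinite coordinate projection. -/
theorem carrier_arReducible_tupleSetCode {A : Set ℕ} {m : ℕ} {X : Set (Fin m → ↥A)} {i : Fin m}
    (hX : ((fun v => v i) '' X)ᶜ.Finite) : ArReducible A (tupleSetCode X) := by
  have h : ArDef (tupleSetCode X) fun x : Fin 1 → ℕ => ∃ v : Fin m → ℕ,
      v i = x 0 ∧ tupleCode v ∈ tupleSetCode X :=
    ArDef.exists (P := fun (x : Fin 1 → ℕ) (v : Fin m → ℕ) =>
      v i = x 0 ∧ tupleCode v ∈ tupleSetCode X)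
      (.and ((ArDefFun.var (Sum.inr i)).eq (.var (Sum.inl 0)))
        (ArDef.mem.mem_of (.tupleCode fun i => .var (Sum.inr i))))
  refine arReducible_iff.2 (((ArDef.mem_finite (hX.image Subtype.val) 0).or h).congr fun x =>
    ⟨?_, fun hx => ?_⟩)
  · rintro (⟨y, -, hy⟩ | ⟨v, hv, w, hw, hvw⟩)
    · exact hy ▸ y.2
    · obtain rfl := tupleCode_injective hvw
      exact hv ▸ (w i).2
  · by_cases hmem : (⟨x 0, hx⟩ : ↥A) ∈ (fun v => v i) '' X
    · obtain ⟨w, hw, hwx⟩ := hmem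
      exact Or.inr ⟨fun j => w j, congrArg Subtype.val hwx, w, hw, rfl⟩
    · exact Or.inl ⟨_, hmem, rfl⟩

/-- **Infinite definable sets have full degree** in arithmetically extendible models of
strongly minimal arithmetically definable theories. -/
theorem infinite_definable_sets_have_full_degree
    (L : FirstOrder.Language) (g : GoedelCoding L)
    (T : L.Theory) (hT : ArithTheory g T) (hcomp : T.IsComplete)
    (hsm : StronglyMinimalTheory L T)
    (M : CodedStructure L) (hM : M.Models T) (hext : ArithExtendible g T M)
    (d : Set ℕ) (hd : ¬ IsArithmetical d) (hdeg : ArEquiv M.carrier d)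
    (m : ℕ) (X : Set (Fin m → ↥M.carrier)) (hX : DefinableIn M X) (hinf : X.Infinite) :
    ArEquiv (tupleSetCode X) d := by
  have hred := hX.tupleSetCode_arReducible g hext
  obtain ⟨i, hi⟩ := exists_infinite_image_eval hinf
  have hcof := (hsm.2 _ M.struc hM _ (hX.definable1_image_eval i)).resolve_left hi
  exact ⟨hred.trans hdeg.1, hdeg.2.trans (carrier_arReducible_tupleSetCode hcof)⟩

end ArMorley
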